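/- arXiv:1607.00436 — 3 statements merged into one kernel-verified Lean document; each statement's English description precedes it below -/
import Mathlib

section
/- (2-approximation for the minimum k-terminal cut.) Let G be a simple graph on a finite vertex set V with nonnegative edge weights w, and let V_1, ..., V_k ⊆ V be pairwise disjoint nonempty sets. For each i, let E_i be an edge set of minimum total weight whose deletion separates V_i from ⋃_{j ≠ i} V_j. Then E = ⋃_{i=1}^k E_i pairwise separates V_1, ..., V_k, and for every edge set E* that pairwise separates V_1, ..., V_k one has w(E) ≤ 2 · w(E*). In particular, E is a 2-approximation of the minimum k-terminal cut problem MKTC({V_1,...,V_k}). -/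
open Finset

theorem SimpleGraph.Reachable.mem_of_adj_closed {V : Type*} {H : SimpleGraph V} {S : Set V}
    (hS : ∀ u v, H.Adj u v → u ∈ S → v ∈ S) {a b : V} (h : H.Reachable a b) (ha : a ∈ S) :
    b ∈ S := by
  obtain ⟨p⟩ := h
  induction p with
  | nil => exact ha
  | cons hadj _ ih => exact ih (hS _ _ hadj ha)

theorem Finset.sum_biUnion_le_sum_sum {ι α M : Type*} [DecidableEq α] [AddCommMonoid M]
    [PartialOrder M] [CanonicallyOrderedAdd M] [IsOrderedAddMonoid M]
    (s : Finset ι) (t : ι → Finset α) (f : α → M) :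
    ∑ a ∈ s.biUnion t, f a ≤ ∑ i ∈ s, ∑ a ∈ t i, f a := by
  classical
  induction s using Finset.induction_on with
  | empty => simp
  | insert i s hi ih =>
    rw [biUnion_insert, sum_insert hi]
    calc ∑ a ∈ t i ∪ s.biUnion t, f a
        ≤ ∑ a ∈ t i ∪ s.biUnion t, f a + ∑ a ∈ t i ∩ s.biUnion t, f a := le_self_add
      _ = ∑ a ∈ t i, f a + ∑ a ∈ s.biUnion t, f a := sum_union_inter
      _ ≤ ∑ a ∈ t i, f a + ∑ j ∈ s, ∑ a ∈ t j, f a := by gcongr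

/-- The two endpoints of an edge meet at most two members of a family of disjoint sets. -/
theorem Sym2.card_filter_exists_mem_le_two {V ι : Type*} [Fintype ι] {S : ι → Set V}
    (hS : ∀ i j v, v ∈ S i → v ∈ S j → i = j) (e : Sym2 V)
    [DecidablePred fun i => ∃ v ∈ e, v ∈ S i] :
    #{i | ∃ v ∈ e, v ∈ S i} ≤ 2 := by
  classical
  obtain ⟨x, y, rfl⟩ : ∃ x y, e = s(x, y) := e.ind fun x y => ⟨x, y, rfl⟩
  have hone (z : V) : #{i | z ∈ S i} ≤ 1 := by
    refine card_le_one.mpr fun i hi j hj => ?_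
    exact hS i j z (mem_filter.mp hi).2 (mem_filter.mp hj).2
  calc #{i | ∃ v ∈ s(x, y), v ∈ S i}
      ≤ #(({i | x ∈ S i} : Finset ι) ∪ ({i | y ∈ S i} : Finset ι)) := by
        refine card_le_card fun i hi => ?_
        simpa using hi
    _ ≤ #{i | x ∈ S i} + #{i | y ∈ S i} := card_union_le _ _
    _ ≤ 2 := add_le_add (hone x) (hone y)

/-- 2-approximation for the minimum k-terminal cut: if for each `i`, `E_i` is a
minimum-weight edge set separating `V_i` from `⋃_{j ≠ i} V_j`, then `E = ⋃ E_i`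
pairwise separates `V_1, ..., V_k`, and `w(E) ≤ 2 · w(E*)` for every edge set `E*`
pairwise separating `V_1, ..., V_k`. -/
theorem union_min_separators_two_approx_MKTC {V : Type*} [Fintype V] [DecidableEq V]
    (G : SimpleGraph V) [DecidableRel G.Adj]
    (w : Sym2 V → NNReal) (hw : ∀ e : Sym2 V, e ∉ G.edgeSet → w e = 0)
    (k : ℕ) (Vs : Fin k → Set V)
    (hne : ∀ i, (Vs i).Nonempty)
    (hdisj : ∀ i j, i ≠ j → Disjoint (Vs i) (Vs j))
    (Ei : Fin k → Finset (Sym2 V))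
    (hEsub : ∀ i, ↑(Ei i) ⊆ G.edgeSet)
    (hEsep : ∀ i, ∀ a ∈ Vs i, ∀ b ∈ ⋃ j ≠ i, Vs j,
      ¬ (G.deleteEdges ↑(Ei i)).Reachable a b)
    (hEmin : ∀ i, ∀ F : Finset (Sym2 V), ↑F ⊆ G.edgeSet →
      (∀ a ∈ Vs i, ∀ b ∈ ⋃ j ≠ i, Vs j, ¬ (G.deleteEdges ↑F).Reachable a b) →
      ∑ e ∈ Ei i, w e ≤ ∑ e ∈ F, w e) :
    (∀ i j, i ≠ j → ∀ a ∈ Vs i, ∀ b ∈ Vs j,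
      ¬ (G.deleteEdges ↑(Finset.univ.biUnion Ei)).Reachable a b)
    ∧ ∀ Estar : Finset (Sym2 V), ↑Estar ⊆ G.edgeSet →
        (∀ i j, i ≠ j → ∀ a ∈ Vs i, ∀ b ∈ Vs j,
          ¬ (G.deleteEdges ↑Estar).Reachable a b) →
        ∑ e ∈ Finset.univ.biUnion Ei, w e ≤ 2 * ∑ e ∈ Estar, w e := by
  classical
  refine ⟨fun i j hij a ha b hb hab => ?_, fun Estar hsub hsep => ?_⟩
  · refine hEsep i a ha b (Set.mem_iUnion₂.mpr ⟨j, hij.symm, hb⟩) (hab.mono ?_)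
    exact G.deleteEdges_anti (by exact_mod_cast subset_biUnion_of_mem Ei (mem_univ i))
  let S : Fin k → Set V := fun i => {v | ∃ a ∈ Vs i, (G.deleteEdges ↑Estar).Reachable a v}
  have hS : ∀ i j v, v ∈ S i → v ∈ S j → i = j := by
    rintro i j v ⟨a, ha, hav⟩ ⟨b, hb, hbv⟩
    by_contra hij
    exact hsep i j hij a ha b hb (hav.trans hbv.symm)
  have hle (i : Fin k) : ∑ e ∈ Ei i, w e ≤ ∑ e ∈ Estar with ∃ v ∈ e, v ∈ S i, w e := by
    refine hEmin i _ (fun e he => hsub (mem_filter.mp he).1) fun a ha b hb hab => ?_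
    obtain ⟨j, hji, hbj⟩ := Set.mem_iUnion₂.mp hb
    have hmem : b ∈ S i := by
      refine hab.mem_of_adj_closed (fun u v huv hu => ?_) ⟨a, ha, .rfl⟩
      obtain ⟨c, hc, hcu⟩ := hu
      rw [SimpleGraph.deleteEdges_adj] at huv
      refine ⟨c, hc, hcu.trans (SimpleGraph.Adj.reachable ?_)⟩
      refine SimpleGraph.deleteEdges_adj.mpr ⟨huv.1, fun he => huv.2 ?_⟩
      exact mem_coe.mpr (mem_filter.mpr ⟨he, u, Sym2.mem_mk_left u v, c, hc, hcu⟩)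
    exact hji (hS j i b ⟨b, hbj, .rfl⟩ hmem)
  calc ∑ e ∈ univ.biUnion Ei, w e
      ≤ ∑ i, ∑ e ∈ Ei i, w e := sum_biUnion_le_sum_sum _ _ _
    _ ≤ ∑ i, ∑ e ∈ Estar with ∃ v ∈ e, v ∈ S i, w e := sum_le_sum fun i _ => hle i
    _ = ∑ e ∈ Estar, #{i | ∃ v ∈ e, v ∈ S i} • w e := by
        simp_rw [sum_filter]
        rw [sum_comm]
        exact sum_congr rfl fun e _ => by rw [← sum_filter, sum_const]
    _ ≤ ∑ e ∈ Estar, 2 * w e := by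
        refine sum_le_sum fun e _ => ?_
        rw [nsmul_eq_mul]
        gcongr
        exact_mod_cast Sym2.card_filter_exists_mem_le_two hS e
    _ = 2 * ∑ e ∈ Estar, w e := (mul_sum _ _ _).symm
end

section
/- Let G be a connected simple graph on a finite vertex set V with nonnegative edge weights w, let k ≥ 2, and let C* = {S_1, ..., S_k} be a k-partition of V whose cut-edge set E* has minimum total weight among all k-partitions of V (a minimum k-way cut). If v_i ∈ S_i for each i (i.e., {v_1,...,v_k} is a terminal set of C*), then the minimum total weight of an edge set whose deletion pairwise separates the singletons {v_1}, ..., {v_k} equals w(E*). -/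
open Finset

/-- The set of cut edges of a partition `S` of the vertices of `G`: edges of `G`
whose two endpoints lie in different parts. -/
def partitionCutEdges {V : Type*} [Fintype V] [DecidableEq V]
    (G : SimpleGraph V) [DecidableRel G.Adj] {k : ℕ} (S : Fin k → Finset V) :
    Finset (Sym2 V) :=
  G.edgeFinset.filter (fun e => ∃ u x, e = s(u, x) ∧ ∃ i j, i ≠ j ∧ u ∈ S i ∧ x ∈ S j)

theorem mem_partitionCutEdges {V : Type*} [Fintype V] [DecidableEq V]
    {G : SimpleGraph V} [DecidableRel G.Adj] {k : ℕ} {S : Fin k → Finset V} {e : Sym2 V} :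
    e ∈ partitionCutEdges G S ↔
      e ∈ G.edgeSet ∧ ∃ u x, e = s(u, x) ∧ ∃ i j, i ≠ j ∧ u ∈ S i ∧ x ∈ S j := by
  simp [partitionCutEdges]

/-- After deleting the cut edges of a cover, no walk leaves the part it starts in. -/
theorem mem_of_reachable_deleteEdges_partitionCutEdges {V : Type*} [Fintype V] [DecidableEq V]
    {G : SimpleGraph V} [DecidableRel G.Adj] {k : ℕ} {S : Fin k → Finset V}
    (hcover : ∀ u : V, ∃ i, u ∈ S i) {i : Fin k} {u x : V} (hu : u ∈ S i)
    (h : (G.deleteEdges ↑(partitionCutEdges G S)).Reachable u x) : x ∈ S i := by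
  obtain ⟨p⟩ := h
  induction p with
  | nil => exact hu
  | @cons a b _ hab _ ih =>
    apply ih
    rw [SimpleGraph.deleteEdges_adj] at hab
    obtain ⟨j, hj⟩ := hcover b
    by_cases hij : i = j
    · exact hij ▸ hj
    · exact absurd (Finset.mem_coe.2 (mem_partitionCutEdges.2
        ⟨hab.1, a, b, rfl, i, j, hij, hu, hj⟩)) hab.2

/-- An edge set whose deletion pairwise separates `k` vertices contains the cut-edge set of some
`k`-partition. -/
theorem exists_partitionCutEdges_subset {V : Type*} [Fintype V] [DecidableEq V]
    (G : SimpleGraph V) [DecidableRel G.Adj] {k : ℕ} [Nonempty (Fin k)] (v : Fin k → V)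
    (E : Finset (Sym2 V))
    (hsep : ∀ i j, i ≠ j → ¬ (G.deleteEdges ↑E).Reachable (v i) (v j)) :
    ∃ S : Fin k → Finset V, (∀ i, (S i).Nonempty) ∧ (∀ i j, i ≠ j → Disjoint (S i) (S j)) ∧
      (∀ u : V, ∃ i, u ∈ S i) ∧ partitionCutEdges G S ⊆ E := by
  let f : V → Fin k := fun u => Classical.epsilon fun i => (G.deleteEdges ↑E).Reachable (v i) u
  have hfv : ∀ i, f (v i) = i := fun i => by
    by_contra hne
    exact hsep _ _ hne (Classical.epsilon_spec
      (p := fun j => (G.deleteEdges ↑E).Reachable (v j) (v i)) ⟨i, .rfl⟩)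
  have hfadj : ∀ u x, (G.deleteEdges ↑E).Adj u x → f u = f x := fun u x h => by
    refine congrArg Classical.epsilon (funext fun i => propext ?_)
    exact ⟨fun hi => hi.trans h.reachable, fun hi => hi.trans h.symm.reachable⟩
  refine ⟨fun i => {u | f u = i}, fun i => ⟨v i, by simp [hfv]⟩, fun i j hij => ?_,
    fun u => ⟨f u, by simp⟩, fun e he => ?_⟩
  · refine Finset.disjoint_left.2 fun u hi hj => hij ?_
    simp only [Finset.mem_filter_univ] at hi hj
    exact hi.symm.trans hj
  · obtain ⟨hG, u, x, rfl, i, j, hij, hu, hx⟩ := mem_partitionCutEdges.1 he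
    simp only [Finset.mem_filter_univ] at hu hx
    by_contra hE
    refine hij (hu.symm.trans ((hfadj u x ?_).trans hx))
    exact SimpleGraph.deleteEdges_adj.2 ⟨hG, by simpa using hE⟩

/-- Let `C* = {S_1, ..., S_k}` be a k-partition of the vertices of a connected graph `G`
whose cut-edge set `E*` has minimum total weight among all k-partitions (a minimum k-way
cut), and let `v_i ∈ S_i` for each `i`. Then the minimum total weight of an edge set
whose deletion pairwise separates the singletons `{v_1}, ..., {v_k}` equals `w(E*)`. -/
theorem min_terminal_cut_eq_min_k_way_cut {V : Type*} [Fintype V] [DecidableEq V]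
    (G : SimpleGraph V) [DecidableRel G.Adj] (hconn : G.Connected)
    (w : Sym2 V → NNReal) (hw : ∀ e : Sym2 V, e ∉ G.edgeSet → w e = 0)
    (k : ℕ) (hk : 2 ≤ k)
    (S : Fin k → Finset V)
    (hne : ∀ i, (S i).Nonempty)
    (hdisj : ∀ i j, i ≠ j → Disjoint (S i) (S j))
    (hcover : ∀ u : V, ∃ i, u ∈ S i)
    (hmin : ∀ S' : Fin k → Finset V, (∀ i, (S' i).Nonempty) →
      (∀ i j, i ≠ j → Disjoint (S' i) (S' j)) → (∀ u : V, ∃ i, u ∈ S' i) →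
      ∑ e ∈ partitionCutEdges G S, w e ≤ ∑ e ∈ partitionCutEdges G S', w e)
    (v : Fin k → V) (hv : ∀ i, v i ∈ S i) :
    IsLeast
      {x : NNReal | ∃ E' : Finset (Sym2 V), ↑E' ⊆ G.edgeSet ∧
        (∀ i j, i ≠ j → ¬ (G.deleteEdges ↑E').Reachable (v i) (v j)) ∧
        x = ∑ e ∈ E', w e}
      (∑ e ∈ partitionCutEdges G S, w e) := by
  constructor
  · refine ⟨partitionCutEdges G S, fun e he => (mem_partitionCutEdges.1 he).1,
      fun i j hij h => ?_, rfl⟩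
    exact Finset.disjoint_left.1 (hdisj i j hij)
      (mem_of_reachable_deleteEdges_partitionCutEdges hcover (hv i) h) (hv j)
  · rintro _ ⟨E', -, hsep, rfl⟩
    have : Nonempty (Fin k) := ⟨⟨0, by omega⟩⟩
    obtain ⟨S', hne', hdisj', hcover', hsub⟩ := exists_partitionCutEdges_subset G v E' hsep
    exact (hmin S' hne' hdisj' hcover').trans (Finset.sum_le_sum_of_subset hsub)
end

section
/- (3-approximation of equal-sized terminal partition via the min-star assignment.) Let V be a finite set with n = q·k elements (q, k positive integers), let w : V → V → ℝ be symmetric and nonnegative with w(u, u) = 0 satisfying the triangle inequality w(u, v) ≤ w(u, x) + w(x, v) for all u, v, x ∈ V, and let v_1, ..., v_k ∈ V be distinct terminals. Call a partition C = {S_1, ..., S_k} of V feasible if |S_i| = q and v_i ∈ S_i for each i; define its cut weight cut(C) = \sum_{i < j} \sum_{u ∈ S_i} \sum_{v ∈ S_j} w(u, v) and its star cost star(C) = \sum_{i=1}^k \sum_{a ∈ S_i} \sum_{r ≠ i} q · w(v_r, a). If C is a feasible partition minimizing star(C) among all feasible partitions, then cut(C) ≤ 3 · cut(C') for every feasible partition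 C'. -/
open Finset

/-- The cut weight of a partition `{S_1,...,S_k}`:
`cut(C) = ∑_{i < j} ∑_{u ∈ S_i} ∑_{x ∈ S_j} w(u, x)`. -/
def cutWeight {V : Type*} [DecidableEq V] {k : ℕ} (w : V → V → ℝ)
    (S : Fin k → Finset V) : ℝ :=
  ∑ i, ∑ j ∈ Finset.univ.filter (fun j => i < j), ∑ u ∈ S i, ∑ x ∈ S j, w u x

/-- The star cost of a partition `{S_1,...,S_k}` with terminals `v_1,...,v_k`:
`star(C) = ∑_i ∑_{a ∈ S_i} ∑_{r ≠ i} q · w(v_r, a)`. -/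
def starCost {V : Type*} [DecidableEq V] {k : ℕ} (q : ℕ) (w : V → V → ℝ)
    (v : Fin k → V) (S : Fin k → Finset V) : ℝ :=
  ∑ i, ∑ a ∈ S i, ∑ r ∈ Finset.univ.filter (fun r => r ≠ i), (q : ℝ) * w (v r) a

/-- A partition `{S_1,...,S_k}` of `V` is feasible if its parts are pairwise disjoint,
cover `V`, each have `q` elements, and `v_i ∈ S_i` for each `i`. -/
def FeasiblePartition {V : Type*} [DecidableEq V] {k : ℕ} (q : ℕ)
    (v : Fin k → V) (S : Fin k → Finset V) : Prop :=
  (∀ i j, i ≠ j → Disjoint (S i) (S j)) ∧ (∀ u : V, ∃ i, u ∈ S i) ∧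
    (∀ i, (S i).card = q) ∧ (∀ i, v i ∈ S i)

/-- Ordered version of the cut weight: summing over ordered pairs of distinct parts counts
every cross pair twice. -/
theorem sum_sum_ne_eq_two_mul_cutWeight {V : Type*} [DecidableEq V] {k : ℕ} (w : V → V → ℝ)
    (hsymm : ∀ u x, w u x = w x u) (S : Fin k → Finset V) :
    ∑ i, ∑ j ∈ univ.filter (fun j => j ≠ i), ∑ u ∈ S i, ∑ x ∈ S j, w u x =
      2 * cutWeight w S := by
  have hswap : ∑ i, ∑ j ∈ univ.filter (fun j => j < i), ∑ u ∈ S i, ∑ x ∈ S j, w u x =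
      cutWeight w S := by
    unfold cutWeight
    simp only [sum_filter]
    rw [sum_comm]
    refine sum_congr rfl fun i _ => sum_congr rfl fun j _ => ?_
    split_ifs with h
    · rw [sum_comm]
      exact sum_congr rfl fun u _ => sum_congr rfl fun x _ => hsymm _ _
    · rfl
  rw [two_mul]
  nth_rewrite 1 [← hswap]
  unfold cutWeight
  simp only [sum_filter, ← sum_add_distrib]
  refine sum_congr rfl fun i _ => sum_congr rfl fun j _ => ?_
  rcases lt_trichotomy i j with h | h | h
  · simp [h, h.ne', h.not_gt]
  · simp [h]
  · simp [h, h.ne, h.not_gt]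

/-- The total weight splits into the weight inside the parts and twice the cut weight. -/
theorem FeasiblePartition.sum_sum_eq {V : Type*} [Fintype V] [DecidableEq V] {q k : ℕ}
    {v : Fin k → V} {S : Fin k → Finset V} (hS : FeasiblePartition q v S) (w : V → V → ℝ)
    (hsymm : ∀ u x, w u x = w x u) :
    ∑ u, ∑ x, w u x = ∑ i, ∑ u ∈ S i, ∑ x ∈ S i, w u x + 2 * cutWeight w S := by
  have hsum (f : V → ℝ) : ∑ u, f u = ∑ i, ∑ u ∈ S i, f u := by
    rw [← sum_biUnion fun i _ j _ hij => hS.1 i j hij]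
    congr 1
    ext u
    simpa using hS.2.1 u
  rw [← sum_sum_ne_eq_two_mul_cutWeight w hsymm, ← sum_add_distrib, hsum]
  refine sum_congr rfl fun i _ => ?_
  simp only [hsum (w _)]
  rw [sum_comm, filter_ne' univ i,
    add_sum_erase univ (fun j => ∑ u ∈ S i, ∑ x ∈ S j, w u x) (mem_univ i)]

/-- For a metric, the weight inside a set is at most twice the weight between it and any
nonempty set of the same size. -/
theorem sum_sum_self_le_two_mul {V : Type*} (w : V → V → ℝ)
    (hsymm : ∀ u x, w u x = w x u) (htri : ∀ u x y, w u x ≤ w u y + w y x)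
    {A B : Finset V} (hAB : A.card = B.card) (hB : 0 < B.card) :
    ∑ u ∈ A, ∑ x ∈ A, w u x ≤ 2 * ∑ u ∈ A, ∑ y ∈ B, w u y := by
  have h : ∑ u ∈ A, ∑ x ∈ A, ∑ _y ∈ B, w u x ≤
      ∑ u ∈ A, ∑ x ∈ A, ∑ y ∈ B, (w u y + w x y) :=
    sum_le_sum fun u _ => sum_le_sum fun x _ => sum_le_sum fun y _ =>
      hsymm x y ▸ htri u x y
  simp only [sum_add_distrib, sum_const, nsmul_eq_mul, ← mul_sum, hAB] at h
  have hB' : (0 : ℝ) < B.card := by exact_mod_cast hB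
  refine le_of_mul_le_mul_left ?_ hB'
  linarith

/-- For a metric, the weight inside the parts of a feasible partition with at least two parts
is at most four times the cut weight. -/
theorem FeasiblePartition.sum_inside_le {V : Type*} [DecidableEq V] {q k : ℕ}
    {v : Fin k → V} {S : Fin k → Finset V} (hS : FeasiblePartition q v S) (hq : 0 < q)
    (hk : 1 < k) (w : V → V → ℝ) (hsymm : ∀ u x, w u x = w x u)
    (hnonneg : ∀ u x, 0 ≤ w u x) (htri : ∀ u x y, w u x ≤ w u y + w y x) :
    ∑ i, ∑ u ∈ S i, ∑ x ∈ S i, w u x ≤ 4 * cutWeight w S := by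
  have : Nontrivial (Fin k) := Fin.nontrivial_iff_two_le.mpr hk
  have hcut := sum_sum_ne_eq_two_mul_cutWeight w hsymm S
  have h : ∑ i, ∑ u ∈ S i, ∑ x ∈ S i, w u x ≤
      ∑ i, 2 * ∑ j ∈ univ.filter (fun j => j ≠ i), ∑ u ∈ S i, ∑ x ∈ S j, w u x := by
    refine sum_le_sum fun i _ => ?_
    obtain ⟨j, hj⟩ := exists_ne i
    have hij := sum_sum_self_le_two_mul w hsymm htri
      ((hS.2.2.1 i).trans (hS.2.2.1 j).symm) (hq.trans_eq (hS.2.2.1 j).symm)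
    have hle := single_le_sum (s := univ.filter (fun j => j ≠ i))
      (f := fun j => ∑ u ∈ S i, ∑ x ∈ S j, w u x)
      (fun j _ => sum_nonneg fun u _ => sum_nonneg fun x _ => hnonneg u x)
      (mem_filter.mpr ⟨mem_univ j, hj⟩)
    linarith
  rw [← mul_sum, hcut] at h
  linarith

/-- 3-approximation of the equal-sized terminal partition via the min-star assignment:
if `V` has `n = q·k` elements, `w` is a symmetric nonnegative weight vanishing on the
diagonal and satisfying the triangle inequality, `v_1,...,v_k` are distinct terminals,
and `C` minimizes the star cost among feasible partitions, then
`cut(C) ≤ 3 · cut(C')` for every feasible partition `C'`. -/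
theorem min_star_three_approx {V : Type*} [Fintype V] [DecidableEq V]
    (q k : ℕ) (hq : 0 < q) (hk : 0 < k)
    (hcard : Fintype.card V = q * k)
    (w : V → V → ℝ)
    (hsymm : ∀ u x, w u x = w x u)
    (hnonneg : ∀ u x, 0 ≤ w u x)
    (hdiag : ∀ u, w u u = 0)
    (htri : ∀ u x y, w u x ≤ w u y + w y x)
    (v : Fin k → V) (hv : Function.Injective v)
    (S : Fin k → Finset V)
    (hfeas : FeasiblePartition q v S)
    (hmin : ∀ S' : Fin k → Finset V, FeasiblePartition q v S' →
      starCost q w v S ≤ starCost q w v S') :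
    ∀ S' : Fin k → Finset V, FeasiblePartition q v S' →
      cutWeight w S ≤ 3 * cutWeight w S' := by
  intro S' hS'
  obtain rfl | hk1 : k = 1 ∨ 1 < k := by omega
  · simp [cutWeight, sum_filter]
  · have hinside : 0 ≤ ∑ i, ∑ u ∈ S i, ∑ x ∈ S i, w u x :=
      sum_nonneg fun i _ => sum_nonneg fun u _ => sum_nonneg fun x _ => hnonneg u x
    have hS_eq := hfeas.sum_sum_eq w hsymm
    have hS'_eq := hS'.sum_sum_eq w hsymm
    have hS'_le := hS'.sum_inside_le hq hk1 w hsymm hnonneg htri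
    linarith
end
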